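/- arXiv:1409.4350 — 2 statements merged into one kernel-verified Lean document; each statement's English description precedes it below -/
import Mathlib

section
/- Fix ω > 0 and for β > 0 set α := ω/β. Then the family is monotone in β: for all 0 < β ≤ β' and all v, w ∈ ℝ one has ψ*_{ω/β,β}(w) ≤ ψ*_{ω/β',β'}(w) and ψ_{ω/β,β}(v) ≥ ψ_{ω/β',β'}(v). -/
open Real Filter Topology Set

/-- `ψ_{α,β}(v)`, the dissipation potential from Kramers' rates. -/
noncomputable def psi (a b v : ℝ) : ℝ :=
  v / b * Real.log ((v + Real.sqrt (v ^ 2 + 4 * a ^ 2)) / (2 * a))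
    - 1 / b * Real.sqrt (v ^ 2 + 4 * a ^ 2) + 2 * a / b

/-- `ψ*_{α,β}(w)`, the dual dissipation potential. -/
noncomputable def psiStar (a b w : ℝ) : ℝ :=
  2 * a / b * (Real.cosh (b * w) - 1)

/-- The tangent line of `cosh` at `x` lies below its graph. -/
theorem cosh_add_sinh_mul_sub_le_cosh (x y : ℝ) :
    Real.cosh x + Real.sinh x * (y - x) ≤ Real.cosh y := by
  have h₁ : Real.exp x * (y - x + 1) ≤ Real.exp y := by
    calc Real.exp x * (y - x + 1) ≤ Real.exp x * Real.exp (y - x) := by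
          gcongr; exact Real.add_one_le_exp _
      _ = Real.exp y := by rw [← Real.exp_add]; ring_nf
  have h₂ : Real.exp (-x) * (x - y + 1) ≤ Real.exp (-y) := by
    calc Real.exp (-x) * (x - y + 1) ≤ Real.exp (-x) * Real.exp (x - y) := by
          gcongr; exact Real.add_one_le_exp _
      _ = Real.exp (-y) := by rw [← Real.exp_add]; ring_nf
  rw [Real.cosh_eq, Real.cosh_eq, Real.sinh_eq]
  linarith

theorem cosh_mul_sub_one_le {t : ℝ} (ht₀ : 0 ≤ t) (ht₁ : t ≤ 1) (z : ℝ) :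
    Real.cosh (t * z) - 1 ≤ t ^ 2 * (Real.cosh z - 1) := by
  have key : Real.cosh (t * z) ≤ t ^ 2 * Real.cosh z + (1 - t ^ 2) := by
    refine hasSum_le (fun n => ?_) (Real.hasSum_cosh (t * z))
      (((Real.hasSum_cosh z).mul_left (t ^ 2)).add (hasSum_ite_eq 0 (1 - t ^ 2)))
    rcases Nat.eq_zero_or_pos n with rfl | hn
    · simp
    · have hpow : t ^ (2 * n) ≤ t ^ 2 := pow_le_pow_of_le_one ht₀ ht₁ (by omega)
      have hz : 0 ≤ z ^ (2 * n) := by rw [pow_mul]; positivity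
      rw [if_neg hn.ne', add_zero, mul_pow, mul_div_assoc]
      gcongr
  linarith

theorem psiStar_div_mono {ω β β' : ℝ} (hω : 0 < ω) (hβ : 0 < β) (hββ' : β ≤ β') (w : ℝ) :
    psiStar (ω / β) β w ≤ psiStar (ω / β') β' w := by
  have hβ' : 0 < β' := hβ.trans_le hββ'
  have h := cosh_mul_sub_one_le (div_nonneg hβ.le hβ'.le) ((div_le_one hβ').2 hββ') (β' * w)
  rw [show β / β' * (β' * w) = β * w by field_simp] at h
  unfold psiStar
  calc 2 * (ω / β) / β * (Real.cosh (β * w) - 1)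
      ≤ 2 * (ω / β) / β * ((β / β') ^ 2 * (Real.cosh (β' * w) - 1)) := by gcongr
    _ = 2 * (ω / β') / β' * (Real.cosh (β' * w) - 1) := by field_simp

theorem sqrt_sq_add_four_mul_sq {a : ℝ} (ha : 0 < a) (v : ℝ) :
    Real.sqrt (v ^ 2 + 4 * a ^ 2) = 2 * a * Real.cosh (Real.arsinh (v / (2 * a))) := by
  rw [Real.cosh_arsinh, show v ^ 2 + 4 * a ^ 2 = (2 * a) ^ 2 * (1 + (v / (2 * a)) ^ 2) by
    field_simp; ring, Real.sqrt_mul (by positivity), Real.sqrt_sq (by positivity)]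

/-- `psi a b v` is the value of `v * w - psiStar a b w` at `w = arsinh (v / (2 * a)) / b`. -/
theorem psi_eq_mul_sub_psiStar {a b : ℝ} (ha : 0 < a) (hb : 0 < b) (v : ℝ) :
    psi a b v = v * (Real.arsinh (v / (2 * a)) / b)
      - psiStar a b (Real.arsinh (v / (2 * a)) / b) := by
  have hlog : Real.log ((v + Real.sqrt (v ^ 2 + 4 * a ^ 2)) / (2 * a))
      = Real.arsinh (v / (2 * a)) := by
    rw [sqrt_sq_add_four_mul_sq ha, add_div, mul_div_cancel_left₀ _ (by positivity),
      Real.cosh_arsinh, Real.arsinh]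
  rw [psi, psiStar, hlog, sqrt_sq_add_four_mul_sq ha, mul_div_cancel₀ _ hb.ne']
  ring

/-- The Fenchel–Young inequality for `psi` and `psiStar`. -/
theorem mul_sub_psiStar_le_psi {a b : ℝ} (ha : 0 < a) (hb : 0 < b) (v w : ℝ) :
    v * w - psiStar a b w ≤ psi a b v := by
  rw [psi_eq_mul_sub_psiStar ha hb, psiStar, psiStar, mul_div_cancel₀ _ hb.ne']
  have hv : v = 2 * a * Real.sinh (Real.arsinh (v / (2 * a))) := by
    rw [Real.sinh_arsinh]; field_simp
  generalize Real.arsinh (v / (2 * a)) = x at hv ⊢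
  subst hv
  have h := mul_le_mul_of_nonneg_left (cosh_add_sinh_mul_sub_le_cosh x (b * w))
    (show 0 ≤ 2 * a / b by positivity)
  have hw : 2 * a * Real.sinh x * w = 2 * a / b * (Real.sinh x * (b * w)) := by field_simp
  rw [hw]
  linear_combination h

/-- fixing `ω > 0` and setting `α = ω/β`, the family is monotone in `β`:
for `0 < β ≤ β'` and all `v, w ∈ ℝ`, `ψ*_{ω/β,β}(w) ≤ ψ*_{ω/β',β'}(w)` and
`ψ_{ω/β,β}(v) ≥ ψ_{ω/β',β'}(v)`. -/
theorem psi_monotone_in_beta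
    (ω : ℝ) (hω : 0 < ω) (β β' : ℝ) (hβ : 0 < β) (hββ' : β ≤ β') (v w : ℝ) :
    psiStar (ω / β) β w ≤ psiStar (ω / β') β' w ∧
    psi (ω / β') β' v ≤ psi (ω / β) β v := by
  have hβ' : 0 < β' := hβ.trans_le hββ'
  refine ⟨psiStar_div_mono hω hβ hββ' w, ?_⟩
  rw [psi_eq_mul_sub_psiStar (div_pos hω hβ') hβ']
  exact (sub_le_sub_left (psiStar_div_mono hω hβ hββ' _) _).trans
    (mul_sub_psiStar_le_psi (div_pos hω hβ) hβ v _)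
end

section
/- For every α, β > 0 and every x ∈ W^{1,1}(0,T): J_{α,β}(x) ≥ 0, and J_{α,β}(x) = 0 if and only if ẋ(t) = −2α·sinh(β·∇E(x(t),t)) for a.e. t ∈ (0,T); i.e. the zero set of the large-deviations rate functional consists exactly of the solutions of the generalized gradient-flow equation. -/
open MeasureTheory Real Filter Topology Set

/-- The gap between `cosh` and its tangent line at `u`, as a sum of nonnegative terms. -/
theorem cosh_tangent_gap_eq (r u : ℝ) :
    cosh r - cosh u - (r - u) * sinh u =
      exp u / 2 * (exp (r - u) - ((r - u) + 1)) +
        exp (-u) / 2 * (exp (-(r - u)) - (-(r - u) + 1)) := by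
  have h₁ : exp r = exp u * exp (r - u) := by rw [← exp_add]; ring_nf
  have h₂ : exp (-r) = exp (-u) * exp (-(r - u)) := by rw [← exp_add]; ring_nf
  rw [cosh_eq, cosh_eq, sinh_eq, h₁, h₂]
  ring

theorem cosh_tangent_gap_nonneg (r u : ℝ) :
    0 ≤ cosh r - cosh u - (r - u) * sinh u := by
  rw [cosh_tangent_gap_eq]
  have h₁ := sub_nonneg.2 (add_one_le_exp (r - u))
  have h₂ := sub_nonneg.2 (add_one_le_exp (-(r - u)))
  positivity

theorem cosh_tangent_gap_eq_zero_iff (r u : ℝ) :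
    cosh r - cosh u - (r - u) * sinh u = 0 ↔ r = u := by
  refine ⟨fun h => ?_, fun h => by simp [h]⟩
  by_contra hne
  have hd : r - u ≠ 0 := sub_ne_zero.2 hne
  have h₁ := sub_pos.2 (add_one_lt_exp hd)
  have h₂ := sub_pos.2 (add_one_lt_exp (neg_ne_zero.2 hd))
  have hpos : 0 < cosh r - cosh u - (r - u) * sinh u := by
    rw [cosh_tangent_gap_eq]
    positivity
  exact hpos.ne' h

theorem psi_two_mul_sinh {a : ℝ} (ha : 0 < a) (b u : ℝ) :
    psi a b (2 * a * sinh u) = 2 * a / b * (u * sinh u - cosh u + 1) := by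
  have hsqrt : √((2 * a * sinh u) ^ 2 + 4 * a ^ 2) = 2 * a * cosh u := by
    rw [show (2 * a * sinh u) ^ 2 + 4 * a ^ 2 = (2 * a * cosh u) ^ 2 by
      rw [mul_pow, mul_pow _ (cosh u), cosh_sq]; ring]
    exact sqrt_sq (by have := cosh_pos u; positivity)
  have harg : (2 * a * sinh u + 2 * a * cosh u) / (2 * a) = exp u := by
    rw [← sinh_add_cosh]
    field_simp
  rw [psi, hsqrt, harg, log_exp]
  ring

/-- The Fenchel–Young gap of `psi` and `psiStar` as a tangent gap of `cosh`. -/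
theorem psi_add_psiStar_add_mul_eq {a b : ℝ} (ha : 0 < a) (hb : 0 < b) (v w : ℝ) :
    psi a b v + psiStar a b w + v * w =
      2 * a / b * (cosh (-(b * w)) - cosh (arsinh (v / (2 * a)))
        - (-(b * w) - arsinh (v / (2 * a))) * sinh (arsinh (v / (2 * a)))) := by
  obtain ⟨u, rfl⟩ : ∃ u, v = 2 * a * sinh u :=
    ⟨arsinh (v / (2 * a)), by rw [sinh_arsinh]; field_simp⟩
  have hdiv : 2 * a * sinh u / (2 * a) = sinh u := by field_simp
  rw [hdiv, arsinh_sinh, psi_two_mul_sinh ha, psiStar, cosh_neg]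
  field_simp
  ring

theorem psi_add_psiStar_add_mul_nonneg {a b : ℝ} (ha : 0 < a) (hb : 0 < b) (v w : ℝ) :
    0 ≤ psi a b v + psiStar a b w + v * w := by
  rw [psi_add_psiStar_add_mul_eq ha hb]
  exact mul_nonneg (by positivity) (cosh_tangent_gap_nonneg _ _)

theorem psi_add_psiStar_add_mul_eq_zero_iff {a b : ℝ} (ha : 0 < a) (hb : 0 < b) (v w : ℝ) :
    psi a b v + psiStar a b w + v * w = 0 ↔ v = -(2 * a) * sinh (b * w) := by
  have hc : 2 * a / b ≠ 0 := by positivity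
  rw [psi_add_psiStar_add_mul_eq ha hb, mul_eq_zero, or_iff_right hc,
    cosh_tangent_gap_eq_zero_iff, ← sinh_inj, sinh_arsinh, sinh_neg,
    eq_div_iff (by positivity), eq_comm]
  ring_nf

theorem measurable_psi (a b : ℝ) : Measurable (psi a b) := by
  unfold psi
  fun_prop

theorem measurable_psiStar (a b : ℝ) : Measurable (psiStar a b) := by
  unfold psiStar
  fun_prop

/-- for every `α, β > 0` and every `x ∈ W^{1,1}(0,T)` (represented by its
absolutely continuous representative and its a.e. derivative `x'`), the large-deviations
rate functional `J_{α,β}(x) = ∫₀ᵀ [ψ_{α,β}(ẋ) + ψ*_{α,β}(∇E(x,t)) + ẋ ∇E(x,t)] dt`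
(with values in `[0,∞]`) satisfies `J_{α,β}(x) ≥ 0`, and `J_{α,β}(x) = 0` iff
`ẋ(t) = −2α sinh(β ∇E(x(t),t))` for a.e. `t ∈ (0,T)`. -/
theorem J_nonneg_and_zero_iff_generalized_gradient_flow
    (T : ℝ) (hT : 0 < T)
    -- the energy `E` with spatial derivative `∇E = DE`, satisfying condition (2.8)
    (E DE : ℝ → ℝ → ℝ) (R L : ℝ)
    (hEcont : Continuous fun p : ℝ × ℝ => E p.1 p.2)
    (hDEcont : Continuous fun p : ℝ × ℝ => DE p.1 p.2)
    (hDE : ∀ y t, HasDerivAt (fun z => E z t) (DE y t) y)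
    (hEnonneg : ∀ y t, 0 ≤ E y t)
    (hDEbound : ∀ y t, |DE y t| ≤ R)
    (hDELip : ∀ y s t, |DE y t - DE y s| ≤ L * |t - s|)
    (a b : ℝ) (ha : 0 < a) (hb : 0 < b)
    -- the curve `x` in `W^{1,1}(0,T)`
    (x x' : ℝ → ℝ)
    (hx'int : IntegrableOn x' (Set.Ioo 0 T))
    (hxac : ∀ t ∈ Set.Icc 0 T, x t = x 0 + ∫ s in (0:ℝ)..t, x' s) :
    0 ≤ (∫⁻ t in Set.Ioo 0 T, ENNReal.ofReal
        (psi a b (x' t) + psiStar a b (DE (x t) t) + x' t * DE (x t) t)) ∧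
    ((∫⁻ t in Set.Ioo 0 T, ENNReal.ofReal
        (psi a b (x' t) + psiStar a b (DE (x t) t) + x' t * DE (x t) t)) = 0 ↔
      ∀ᵐ t ∂(volume.restrict (Set.Ioo 0 T)),
        x' t = -(2 * a) * Real.sinh (b * DE (x t) t)) := by
  refine ⟨zero_le, ?_⟩
  have hx'Icc : IntegrableOn x' (uIcc 0 T) := by
    rwa [uIcc_of_le hT.le, integrableOn_Icc_iff_integrableOn_Ioo]
  have hxcont : ContinuousOn x (Ioo 0 T) := by
    have hprim : ContinuousOn (fun t => x 0 + ∫ s in (0 : ℝ)..t, x' s) (Icc 0 T) := by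
      have h := intervalIntegral.continuousOn_primitive_interval hx'Icc
      rw [uIcc_of_le hT.le] at h
      exact continuousOn_const.add h
    exact (hprim.congr hxac).mono Ioo_subset_Icc_self
  have hDEmeas : AEMeasurable (fun t => DE (x t) t) (volume.restrict (Ioo 0 T)) :=
    (hDEcont.comp_continuousOn (hxcont.prodMk continuousOn_id)).aemeasurable measurableSet_Ioo
  have hx'meas : AEMeasurable x' (volume.restrict (Ioo 0 T)) := hx'int.aemeasurable
  have hmeas : AEMeasurable (fun t => ENNReal.ofReal
      (psi a b (x' t) + psiStar a b (DE (x t) t) + x' t * DE (x t) t))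
      (volume.restrict (Ioo 0 T)) :=
    ((((measurable_psi a b).comp_aemeasurable hx'meas).add
      ((measurable_psiStar a b).comp_aemeasurable hDEmeas)).add
        (hx'meas.mul hDEmeas)).ennreal_ofReal
  rw [lintegral_eq_zero_iff' hmeas]
  refine eventually_congr (Eventually.of_forall fun t => ?_)
  rw [Pi.zero_apply, ENNReal.ofReal_eq_zero,
    (psi_add_psiStar_add_mul_nonneg ha hb _ _).ge_iff_eq',
    psi_add_psiStar_add_mul_eq_zero_iff ha hb]
end
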